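/- The kernel of Φ_{x→p,q}: Sol → Sol′ is the ideal of Sol generated by M_1(𝕏): an element f ∈ Sol satisfies Φ_{x→p,q}(f) = 0 if and only if there exists a stable polynomial g with f_n = (Σ_{i=1}^n (−1)^i x_i)·g_n for all n. -/

import Mathlib

open MvPolynomial

/-- Sequences of polynomials: the `n`-th term is thought of as a polynomial in
`x_1, …, x_n` (variable `j : ℕ` corresponds to `x_{j+1}`). -/
abbrev PolySeq : Type := (n : ℕ) → MvPolynomial ℕ ℂ

/-- The algebra morphism substituting `0` for the variable `x_{n+1}` (index `n`). -/
noncomputable def killVar (n : ℕ) : MvPolynomial ℕ ℂ →ₐ[ℂ] MvPolynomial ℕ ℂ :=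
  aeval (fun j => if j = n then 0 else X j)

/-- `f` is a *stable polynomial*: `f n` only involves `x_1, …, x_n` and setting the last
variable of `f (n+1)` to zero gives back `f n`. -/
def IsStable (f : PolySeq) : Prop :=
  (∀ n, f n ∈ supported ℂ (Set.Iio n)) ∧ ∀ n, killVar n (f (n + 1)) = f n

/-- The substitution `x_{j+2} := x_{j+1}` (0-based : variable `j+1` is replaced by variable `j`). -/
noncomputable def collapse (j : ℕ) : MvPolynomial ℕ ℂ →ₐ[ℂ] MvPolynomial ℕ ℂ :=
  aeval (fun k => if k = j + 1 then X j else X k)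

/-- Renaming of variables skipping the two indices `j`, `j+1`. -/
noncomputable def skip2 (j : ℕ) : MvPolynomial ℕ ℂ →ₐ[ℂ] MvPolynomial ℕ ℂ :=
  rename (fun k => if k < j then k else k + 2)

/-- The functional equation (1) of the paper: substituting `x_{i+1} = x_i` in `f_n` yields
`f_{n-2} (x_1, …, x_{i-1}, x_{i+2}, …, x_n)`. -/
def IsSol (f : PolySeq) : Prop :=
  IsStable f ∧ ∀ n j : ℕ, j + 2 ≤ n → collapse j (f n) = skip2 j (f (n - 2))

/-- Homogeneity of degree `d` for a stable polynomial. -/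
def IsHomogSeq (f : PolySeq) (d : ℕ) : Prop := ∀ n, (f n).IsHomogeneous d

private lemma homog_smul {p : MvPolynomial ℕ ℂ} {d : ℕ} (c : ℂ) (h : p.IsHomogeneous d) :
    (c • p).IsHomogeneous d := by
  rw [smul_eq_C_mul]
  simpa using (isHomogeneous_C ℕ c).mul h

/-- The homogeneous component of degree `d` of the space of solutions of the
functional equation, as a `ℂ`-vector space. -/
noncomputable def SolHomog (d : ℕ) : Submodule ℂ PolySeq where
  carrier := {f | IsSol f ∧ IsHomogSeq f d}
  zero_mem' := by
    refine ⟨⟨⟨fun n => Subalgebra.zero_mem _, fun n => by simp only [Pi.zero_apply, map_zero]⟩,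
      fun n j _ => by simp only [Pi.zero_apply, map_zero]⟩, fun n => isHomogeneous_zero _ _ _⟩
  add_mem' := by
    rintro a b ⟨⟨⟨ha1, ha2⟩, ha3⟩, ha4⟩ ⟨⟨⟨hb1, hb2⟩, hb3⟩, hb4⟩
    refine ⟨⟨⟨fun n => Subalgebra.add_mem _ (ha1 n) (hb1 n), fun n => ?_⟩, fun n j h => ?_⟩,
      fun n => (ha4 n).add (hb4 n)⟩
    · simp only [Pi.add_apply, map_add, ha2 n, hb2 n]
    · simp only [Pi.add_apply, map_add, ha3 n j h, hb3 n j h]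
  smul_mem' := by
    rintro c a ⟨⟨⟨ha1, ha2⟩, ha3⟩, ha4⟩
    refine ⟨⟨⟨fun n => Subalgebra.smul_mem _ (ha1 n) c, fun n => ?_⟩, fun n j h => ?_⟩,
      fun n => homog_smul c (ha4 n)⟩
    · simp only [Pi.smul_apply, map_smul, ha2 n]
    · simp only [Pi.smul_apply, map_smul, ha3 n j h]

/-- The stable polynomial `M_1(𝕏)`, whose `n`-th component is `∑_{i=1}^n (-1)^i x_i`
(0-based: `∑_{j<n} (-1)^{j+1} x_{j+1}`). -/
noncomputable def M1X : PolySeq := fun n => ∑ i ∈ Finset.range n, ((-1 : ℂ)) ^ (i + 1) • X i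

/-- Polynomials in the two families of (commuting) variables `p_1, p_2, …` (`Sum.inl`, 0-based)
and `q_1, q_2, …` (`Sum.inr`, 0-based). -/
abbrev PQPoly : Type := MvPolynomial (ℕ ⊕ ℕ) ℂ

/-- Sequences of polynomials, the `m`-th term being thought of as a polynomial in
`p_1, …, p_m, q_1, …, q_m`. -/
abbrev PQSeq : Type := (m : ℕ) → PQPoly

/-- The variables `p_1, …, p_m, q_1, …, q_m`. -/
def pqVars (m : ℕ) : Set (ℕ ⊕ ℕ) := Sum.inl '' Set.Iio m ∪ Sum.inr '' Set.Iio m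

/-- Substituting `0` for both `p_{m+1}` and `q_{m+1}` (0-based index `m`). -/
noncomputable def killPQ (m : ℕ) : PQPoly →ₐ[ℂ] PQPoly :=
  aeval (Sum.elim (fun k => if k = m then 0 else X (Sum.inl k))
    (fun k => if k = m then 0 else X (Sum.inr k)))

/-- `h` is a two-alphabet stable polynomial. -/
def IsStablePQ (h : PQSeq) : Prop :=
  (∀ m, h m ∈ supported ℂ (pqVars m)) ∧ ∀ m, killPQ m (h (m + 1)) = h m

/-- Substituting `0` for the variable `v0`. -/
noncomputable def subst0PQ (v0 : ℕ ⊕ ℕ) : PQPoly →ₐ[ℂ] PQPoly :=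
  aeval (fun v => if v = v0 then 0 else X v)

/-- The substitution describing the right-hand side of equation (EqQZero) : the parts
`p_{j+1}` and `p_{j+2}` are merged (`0`-based : `p_j`, `p_{j+1}`) and `q_{j+1}` is removed. -/
noncomputable def mergeP (j : ℕ) : PQPoly →ₐ[ℂ] PQPoly :=
  aeval (Sum.elim
    (fun k => if k < j then X (Sum.inl k)
      else if k = j then X (Sum.inl j) + X (Sum.inl (j + 1)) else X (Sum.inl (k + 1)))
    (fun k => if k < j then X (Sum.inr k) else X (Sum.inr (k + 1))))

/-- The substitution describing the right-hand side of equation (EqPZero) : `p_{j+1}`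
(0-based `p_j`, `1 ≤ j`) is removed and the parts `q_{j-1}`, `q_j` (0-based) are merged. -/
noncomputable def mergeQ (j : ℕ) : PQPoly →ₐ[ℂ] PQPoly :=
  aeval (Sum.elim
    (fun k => if k < j then X (Sum.inl k) else X (Sum.inl (k + 1)))
    (fun k => if k + 1 < j then X (Sum.inr k)
      else if k + 1 = j then X (Sum.inr k) + X (Sum.inr (k + 1)) else X (Sum.inr (k + 1))))

/-- The shift substitution, for the case `p_1 = 0` of equation (EqPZero). -/
noncomputable def shiftPQ : PQPoly →ₐ[ℂ] PQPoly :=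
  aeval (Sum.elim (fun k => X (Sum.inl (k + 1))) (fun k => X (Sum.inr (k + 1))))

/-- The system of equations (EqQZero)-(EqPZero) defining `Sol'`: a two alphabet stable
polynomial whose components take the same values on any two multirectangular descriptions of
a Young diagram. -/
def IsSolPQ (h : PQSeq) : Prop :=
  IsStablePQ h ∧
  (∀ m j, j + 2 ≤ m → subst0PQ (Sum.inr j) (h m) = mergeP j (h (m - 1))) ∧
  (∀ m, 1 ≤ m → subst0PQ (Sum.inr (m - 1)) (h m) = h (m - 1)) ∧
  (∀ m j, 1 ≤ j → j + 1 ≤ m → subst0PQ (Sum.inl j) (h m) = mergeQ j (h (m - 1))) ∧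
  (∀ m, 1 ≤ m → subst0PQ (Sum.inl 0) (h m) = shiftPQ (h (m - 1)))

/-- The polynomial expression of the interlacing coordinate `x_{t+1}` (0-based index `t`)
in terms of multirectangular coordinates:
`x_{2i+1} = (q_{i+1} + … + q_m) - (p_1 + … + p_i)` and
`x_{2i} = (q_i + … + q_m) - (p_1 + … + p_i)`. -/
noncomputable def xExpr (m t : ℕ) : PQPoly :=
  (∑ k ∈ Finset.Ico (if t % 2 = 0 then (t + 1) / 2 else (t + 1) / 2 - 1) m, X (Sum.inr k))
    - ∑ k ∈ Finset.range ((t + 1) / 2), X (Sum.inl k)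

/-- The change of variables `Φ_{x → p,q}` from interlacing to multirectangular coordinates. -/
noncomputable def PhiXtoPQ (f : PolySeq) : PQSeq :=
  fun m => aeval (xExpr m) (f (2 * m + 1))

/-- The multirectangular coordinates in terms of interlacing coordinates:
`p_i = x_{2i-1} - x_{2i}` and `q_i = x_{2i} - x_{2i+1}` (all 0-based here). -/
noncomputable def pqExpr : (ℕ ⊕ ℕ) → MvPolynomial ℕ ℂ :=
  Sum.elim (fun k => X (2 * k) - X (2 * k + 1)) (fun k => X (2 * k + 1) - X (2 * k + 2))

/-- The change of variables `Φ_{p,q → x}` from multirectangular to interlacing coordinates. -/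
noncomputable def PhiPQtoX (h : PQSeq) : PolySeq :=
  fun n => if n % 2 = 1 then aeval pqExpr (h (n / 2))
    else killVar n (aeval pqExpr (h (n / 2)))

lemma aeval_congr_of_mem_supported {σ R A : Type*} [CommSemiring R] [CommSemiring A]
    [Algebra R A] {s : Set σ} {p : MvPolynomial σ R} (hp : p ∈ supported R s) {u v : σ → A}
    (h : ∀ i ∈ s, u i = v i) : aeval u p = aeval v p := by
  rw [mem_supported] at hp
  exact eval₂Hom_congr' rfl (fun i hi _ => h i (hp hi)) rfl

lemma dvd_aeval_X_add_sub {σ R : Type*} [CommRing R] (a p : MvPolynomial σ R) :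
    a ∣ aeval (fun i => X i + a) p - p := by
  induction p using MvPolynomial.induction_on with
  | C r => simp
  | add p q hp hq =>
    rw [map_add, add_sub_add_comm]
    exact dvd_add hp hq
  | mul_X p i hp =>
    rw [map_mul, aeval_X, mul_add, add_sub_right_comm, ← sub_mul]
    exact dvd_add (hp.mul_right _) (dvd_mul_left _ _)

lemma M1X_succ (n : ℕ) : M1X (n + 1) = M1X n + (-1 : ℂ) ^ (n + 1) • X n :=
  Finset.sum_range_succ _ _

lemma M1X_two_mul (m : ℕ) :
    M1X (2 * m) = -∑ k ∈ Finset.range m, (X (2 * k) - X (2 * k + 1)) := by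
  induction m with
  | zero => simp [M1X]
  | succ m ih =>
    rw [show 2 * (m + 1) = 2 * m + 1 + 1 by ring, M1X_succ, M1X_succ, ih,
      Finset.sum_range_succ, (even_two_mul m).add_one.neg_one_pow,
      (even_two_mul m).add_one.add_one.neg_one_pow]
    simp only [neg_smul, one_smul]
    ring

lemma M1X_two_mul_add_one (m : ℕ) : M1X (2 * m + 1) = M1X (2 * m) - X (2 * m) := by
  rw [M1X_succ, (even_two_mul m).add_one.neg_one_pow, neg_smul, one_smul, sub_eq_add_neg]

lemma M1X_ne_zero {n : ℕ} (hn : n ≠ 0) : M1X n ≠ 0 := by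
  intro h
  have h' := congrArg (aeval (fun j : ℕ => if j = 0 then (1 : ℂ) else 0)) h
  simp [M1X, hn] at h'

lemma xExpr_two_mul (m i : ℕ) :
    xExpr m (2 * i) =
      ∑ k ∈ Finset.Ico i m, X (Sum.inr k) - ∑ k ∈ Finset.range i, X (Sum.inl k) := by
  rw [xExpr, if_pos (by lia), show (2 * i + 1) / 2 = i by lia]

lemma xExpr_two_mul_add_one (m i : ℕ) :
    xExpr m (2 * i + 1) = xExpr m (2 * i) - X (Sum.inl i) := by
  rw [xExpr_two_mul, xExpr, if_neg (by lia), show (2 * i + 1 + 1) / 2 = i + 1 by lia,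
    Nat.add_sub_cancel, Finset.sum_range_succ, sub_sub]

lemma aeval_xExpr_M1X (m : ℕ) : aeval (xExpr m) (M1X (2 * m + 1)) = 0 := by
  rw [M1X_two_mul_add_one, M1X_two_mul]
  simp [xExpr_two_mul_add_one, xExpr_two_mul m m]

lemma aeval_pqExpr_xExpr_two_mul {m i : ℕ} (h : i ≤ m) :
    aeval pqExpr (xExpr m (2 * i)) = X (2 * i) + M1X (2 * m + 1) := by
  rw [xExpr_two_mul]
  simp only [map_sub, map_sum, aeval_X, pqExpr, Sum.elim_inl, Sum.elim_inr]
  induction m, h using Nat.le_induction with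
  | base => simp [M1X_two_mul_add_one, M1X_two_mul]
  | succ m h ih =>
    rw [Finset.sum_Ico_succ_top h, add_sub_right_comm, ih, M1X_two_mul_add_one (m + 1),
      show 2 * (m + 1) = 2 * m + 1 + 1 by ring, M1X_succ (2 * m + 1),
      (even_two_mul m).add_one.add_one.neg_one_pow, one_smul]
    ring

lemma aeval_pqExpr_xExpr {m t : ℕ} (h : t < 2 * m + 1) :
    aeval pqExpr (xExpr m t) = X t + M1X (2 * m + 1) := by
  obtain ⟨i, rfl | rfl⟩ := Nat.even_or_odd' t
  · exact aeval_pqExpr_xExpr_two_mul (by lia)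
  · rw [xExpr_two_mul_add_one, map_sub, aeval_pqExpr_xExpr_two_mul (by lia), aeval_X, pqExpr,
      Sum.elim_inl]
    ring

lemma M1X_dvd_of_aeval_xExpr_eq_zero {m : ℕ} {p : MvPolynomial ℕ ℂ}
    (hp : p ∈ supported ℂ (Set.Iio (2 * m + 1))) (h : aeval (xExpr m) p = 0) :
    M1X (2 * m + 1) ∣ p := by
  have h' : aeval (fun t => X t + M1X (2 * m + 1)) p = (0 : MvPolynomial ℕ ℂ) := by
    rw [← map_zero (aeval (R := ℂ) pqExpr), ← h, ← AlgHom.comp_apply, comp_aeval]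
    exact aeval_congr_of_mem_supported hp fun t ht => (aeval_pqExpr_xExpr ht).symm
  have hdvd := dvd_aeval_X_add_sub (M1X (2 * m + 1)) p
  rwa [h', zero_sub, dvd_neg] at hdvd

/-- The algebra morphism substituting `0` for all variables of index at least `n`. -/
noncomputable def truncVars (n : ℕ) : MvPolynomial ℕ ℂ →ₐ[ℂ] MvPolynomial ℕ ℂ :=
  aeval (fun j => if j < n then X j else 0)

lemma truncVars_mem_supported (n : ℕ) (p : MvPolynomial ℕ ℂ) :
    truncVars n p ∈ supported ℂ (Set.Iio n) := by
  induction p using MvPolynomial.induction_on with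
  | C r => simpa [truncVars] using (supported ℂ (Set.Iio n)).algebraMap_mem r
  | add p q hp hq =>
    rw [map_add]
    exact add_mem hp hq
  | mul_X p i hp =>
    rw [map_mul]
    refine mul_mem hp ?_
    rw [truncVars, aeval_X]
    split_ifs with hi
    · exact X_mem_supported.2 hi
    · exact zero_mem _

lemma truncVars_eq_self {n : ℕ} {p : MvPolynomial ℕ ℂ} (hp : p ∈ supported ℂ (Set.Iio n)) :
    truncVars n p = p :=
  (aeval_congr_of_mem_supported hp fun _ hi => if_pos hi).trans (aeval_X_left_apply p)

lemma truncVars_killVar (n : ℕ) (p : MvPolynomial ℕ ℂ) :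
    truncVars n (killVar n p) = truncVars n p := by
  rw [← AlgHom.comp_apply]
  congr 1
  ext1 j
  by_cases hj : j = n <;> simp [truncVars, killVar, hj]

lemma killVar_truncVars_succ (n : ℕ) (p : MvPolynomial ℕ ℂ) :
    killVar n (truncVars (n + 1) p) = truncVars n p := by
  rw [← AlgHom.comp_apply]
  congr 1
  ext1 j
  rcases lt_trichotomy j n with hj | rfl | hj
  · simp [truncVars, killVar, hj, hj.le, hj.ne]
  · simp [truncVars, killVar]
  · simp [truncVars, killVar, hj.not_gt, hj.not_ge]

lemma truncVars_truncVars_succ (n : ℕ) (p : MvPolynomial ℕ ℂ) :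
    truncVars n (truncVars (n + 1) p) = truncVars n p := by
  rw [← killVar_truncVars_succ, truncVars_eq_self (truncVars_mem_supported _ _),
    killVar_truncVars_succ]

lemma killVar_M1X_succ (n : ℕ) : killVar n (M1X (n + 1)) = M1X n := by
  rw [M1X_succ, map_add, map_smul, M1X, map_sum]
  simp only [killVar, aeval_X, map_smul, if_true, smul_zero, add_zero]
  exact Finset.sum_congr rfl fun i hi => by rw [if_neg (Finset.mem_range.1 hi).ne]

lemma truncVars_M1X_succ (n : ℕ) : truncVars n (M1X (n + 1)) = M1X n := by
  rw [← truncVars_killVar, killVar_M1X_succ, truncVars_eq_self]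
  exact sum_mem fun i hi =>
    Subalgebra.smul_mem _ (X_mem_supported.2 (Set.mem_Iio.2 (Finset.mem_range.1 hi))) _

lemma IsStable.truncVars_succ {f : PolySeq} (hf : IsStable f) (n : ℕ) :
    truncVars n (f (n + 1)) = f n := by
  rw [← truncVars_killVar, hf.2, truncVars_eq_self (hf.1 n)]

lemma IsStable.exists_eq_M1X_mul {f : PolySeq} (hf : IsStable f) (h : ∀ n, M1X n ∣ f n) :
    ∃ g : PolySeq, IsStable g ∧ ∀ n, f n = M1X n * g n := by
  choose q hq using h
  have hfq (n : ℕ) : f n = M1X n * truncVars n (q (n + 1)) := by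
    rw [← hf.truncVars_succ, hq, map_mul, truncVars_M1X_succ]
  have hqq (n : ℕ) : truncVars (n + 1) (q (n + 2)) = q (n + 1) :=
    mul_left_cancel₀ (M1X_ne_zero n.succ_ne_zero) ((hfq (n + 1)).symm.trans (hq (n + 1)))
  refine ⟨fun n => truncVars n (q (n + 1)), ⟨fun n => truncVars_mem_supported _ _, fun n => ?_⟩,
    hfq⟩
  change killVar n (truncVars (n + 1) (q (n + 2))) = truncVars n (q (n + 1))
  rw [killVar_truncVars_succ, ← hqq n, truncVars_truncVars_succ]

lemma IsStable.M1X_dvd {f : PolySeq} (hf : IsStable f) (h : PhiXtoPQ f = 0) (n : ℕ) :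
    M1X n ∣ f n := by
  have hodd (m : ℕ) : M1X (2 * m + 1) ∣ f (2 * m + 1) :=
    M1X_dvd_of_aeval_xExpr_eq_zero (hf.1 _) (congrFun h m)
  obtain ⟨m, rfl | rfl⟩ := Nat.even_or_odd' n
  · rw [← hf.2, ← killVar_M1X_succ]
    exact map_dvd _ (hodd m)
  · exact hodd m

/-- The kernel of `Φ_{x→p,q} : Sol → Sol'` is the ideal generated by
`M_1(𝕏)`. -/
theorem ker_phiXtoPQ_eq_ideal_M1 (f : PolySeq) (hf : IsSol f) :
    PhiXtoPQ f = 0 ↔ ∃ g : PolySeq, IsStable g ∧ ∀ n, f n = M1X n * g n := by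
  refine ⟨fun h => hf.1.exists_eq_M1X_mul (hf.1.M1X_dvd h), ?_⟩
  rintro ⟨g, -, hg⟩
  funext m
  rw [PhiXtoPQ, hg, map_mul, aeval_xExpr_M1X, zero_mul, Pi.zero_apply]
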